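/- For all real numbers m > 0, N > 0 and L > 0, the following strict inequality between the ratio of computational costs of the dimension-wise and basis-derived approaches holds: 4(m+2)NL / (2m(3m+1)N + 3m(m+1)L) > H(2N, L) / (3m), where H(x₁, x₂) = 2x₁x₂/(x₁ + x₂) denotes the harmonic mean of two positive real numbers. -/

import Mathlib

/-- Harmonic mean of two positive real numbers. -/
noncomputable def harmonicMean (x₁ x₂ : ℝ) : ℝ := 2 * x₁ * x₂ / (x₁ + x₂)

/-- The ratio of computational costs between the dimension-wise and basis-derived
approaches is strictly larger than `H(2N, L) / (3m)`, where `H` is the harmonic mean. -/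
theorem cost_ratio_gt_harmonic (m N L : ℝ) (hm : 0 < m) (hN : 0 < N) (hL : 0 < L) :
    4 * (m + 2) * N * L / (2 * m * (3 * m + 1) * N + 3 * m * (m + 1) * L)
      > harmonicMean (2 * N) L / (3 * m) := by
  rw [gt_iff_lt, harmonicMean, div_div, div_lt_div_iff₀ (by positivity) (by positivity)]
  have h : 0 < 4 * N * L * (10 * m * N + 3 * m * L) := by positivity
  linear_combination h
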